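/- Let n > 1 be an integer. For 0 ≤ z ≤ (log n)/(2σ_n), let β_n(z) be the unique nonnegative real solution β of φ_n'(β) = (1/2)·log n + z·σ_n. Then z ↦ β_n(z) is differentiable on [0, (log n)/(2σ_n)) and β_n'(z) ≥ 1/σ_n for all z in this interval. -/

import Mathlib

open Finset MeasureTheory
open scoped Classical

noncomputable section

/-- The set of primes `p ≤ y`. -/
def primesUpTo (y : ℝ) : Finset ℕ := (Finset.range (⌊y⌋₊ + 1)).filter Nat.Prime

/-- `S(x,y)`: the set of `y`-friable integers in `[1,x]`. -/
def Sf (x y : ℝ) : Finset ℕ :=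
  (Finset.Icc 1 ⌊x⌋₊).filter fun n => ∀ p : ℕ, p.Prime → p ∣ n → (p : ℝ) ≤ y

/-- `Ψ(x,y)`. -/
def Psi (x y : ℝ) : ℝ := (Sf x y).card

/-- `u = log x / log y`. -/
def uQ (x y : ℝ) : ℝ := Real.log x / Real.log y

/-- `ū = min(u, π(y))`. -/
def ubar (x y : ℝ) : ℝ := min (uQ x y) ((primesUpTo y).card)

/-- `ν_{x,y}(A) = |A ∩ S(x,y)| / Ψ(x,y)`. -/
def nuMeas (x y : ℝ) (A : Set ℕ) : ℝ :=
  (((Sf x y).filter fun n => n ∈ A).card : ℝ) / Psi x y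

/-- `P(D_n ≥ t) = #{d ∣ n : log d ≥ t} / τ(n)`. -/
def DnProb (n : ℕ) (t : ℝ) : ℝ :=
  ((n.divisors.filter fun d => t ≤ Real.log d).card : ℝ) / (n.divisors.card : ℝ)

/-- `m_{2,n}`. -/
def m2 (n : ℕ) : ℝ :=
  (1 / 12) * ∑ p ∈ n.primeFactors,
    (n.factorization p : ℝ) * ((n.factorization p : ℝ) + 2) * Real.log p ^ 2

/-- `m_{4,n}`. -/
def m4 (n : ℕ) : ℝ :=
  (1 / 240) * ∑ p ∈ n.primeFactors,
    (n.factorization p : ℝ) * ((n.factorization p : ℝ) + 2) *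
      (3 * (n.factorization p : ℝ) ^ 2 + 6 * (n.factorization p : ℝ) - 4) * Real.log p ^ 4

/-- `σ_n = √(m_{2,n})`. -/
def sigman (n : ℕ) : ℝ := Real.sqrt (m2 n)

/-- `w_n = m_{2,n}² / m_{4,n}`, with `w_1 = 1`. -/
def wn (n : ℕ) : ℝ := if n = 1 then 1 else m2 n ^ 2 / m4 n

/-- `Φ(z) = (1/√(2π)) ∫_z^∞ e^{-t²/2} dt`. -/
def GaussPhi (z : ℝ) : ℝ :=
  (1 / Real.sqrt (2 * Real.pi)) * ∫ t in Set.Ioi z, Real.exp (-t ^ 2 / 2)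

/-- `ω̃_{x,y}(n)`. -/
def omegaTilde (x y : ℝ) (n : ℕ) : ℕ :=
  ((n.primeFactors).filter fun p : ℕ =>
    Real.sqrt y < (p : ℝ) ∧ (p : ℝ) ≤ y ∧
      uQ x y / (2 * ubar x y) ≤ (n.factorization p : ℝ) ∧
      (n.factorization p : ℝ) ≤ 2 * uQ x y / ubar x y).card

/-- The saddle-point equation defining `α(x,y)`. -/
def saddleEq (x y α : ℝ) : Prop :=
  ∑ p ∈ primesUpTo y, Real.log p / ((p : ℝ) ^ α - 1) = Real.log x

/-- `σ̄(x,y)` (in terms of `y` and `α`). -/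
def sigmaBar (y α : ℝ) : ℝ :=
  Real.sqrt ((1 / 2) * ∑ p ∈ primesUpTo y,
    ((p : ℝ) ^ α - 1 / 3) * Real.log p ^ 2 / ((p : ℝ) ^ α - 1) ^ 2)

/-- `ζ(α,y)`. -/
def zetaY (y α : ℝ) : ℝ := ∏ p ∈ primesUpTo y, (1 - (p : ℝ) ^ (-α))⁻¹

/-- `f_k(n) = ∑_{p^ν ‖ n} (ν log p)^k`. -/
def fk (k : ℕ) (n : ℕ) : ℝ :=
  ∑ p ∈ n.primeFactors, ((n.factorization p : ℝ) * Real.log p) ^ k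

/-- `A_f(x,y) = ∑_{p ≤ y} ∑_{ν ≥ 1} f(p^ν) p^{-να} (1 - p^{-α})`. -/
def Af (y α : ℝ) (f : ℕ → ℝ) : ℝ :=
  ∑ p ∈ primesUpTo y, ∑' ν : ℕ,
    f (p ^ (ν + 1)) * (p : ℝ) ^ (-(((ν : ℝ) + 1) * α)) * (1 - (p : ℝ) ^ (-α))

/-- `Z_n(β)` for real `β` (each Euler factor written as the everywhere-defined mean
`(1/(ν+1)) ∑_{0 ≤ j ≤ ν} p^{jβ}`, which is the continuous extension of
`(p^{(ν+1)β}-1)/((ν+1)(p^β-1))`). -/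
def ZnR (n : ℕ) (β : ℝ) : ℝ :=
  ∏ p ∈ n.primeFactors,
    (∑ j ∈ Finset.range (n.factorization p + 1), (p : ℝ) ^ ((j : ℝ) * β)) /
      ((n.factorization p : ℝ) + 1)

/-- `φ_n = log Z_n` on the reals. -/
def phiN (n : ℕ) (β : ℝ) : ℝ := Real.log (ZnR n β)

/-- `Z_n(s)` for complex `s`. -/
def ZnC (n : ℕ) (s : ℂ) : ℂ :=
  ∏ p ∈ n.primeFactors,
    (∑ j ∈ Finset.range (n.factorization p + 1), (p : ℂ) ^ ((j : ℂ) * s)) /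
      ((n.factorization p : ℂ) + 1)

/-- Distance from `θ` to the nearest integer. -/
def nid (θ : ℝ) : ℝ := |θ - round θ|

/-- `V_y(s) = (y^{1-s} - 1)/(1 - s)`, extended by continuity at `s = 1`. -/
def Vy (y : ℝ) (s : ℂ) : ℂ :=
  if s = 1 then (Real.log y : ℂ) else (((y : ℝ) : ℂ) ^ (1 - s) - 1) / (1 - s)

/-- The exponential power sum `∑_{0 ≤ j ≤ ν} j^k e^{jt}`. -/
def expMoment (k ν : ℕ) (t : ℝ) : ℝ :=
  ∑ j ∈ Finset.range (ν + 1), (j : ℝ) ^ k * Real.exp (j * t)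

theorem expMoment_zero_pos (ν : ℕ) (t : ℝ) : 0 < expMoment 0 ν t := by
  unfold expMoment
  exact Finset.sum_pos (fun j _ => by positivity) ⟨0, by simp⟩

theorem hasStrictDerivAt_expMoment (k ν : ℕ) (t : ℝ) :
    HasStrictDerivAt (expMoment k ν) (expMoment (k + 1) ν t) t := by
  unfold expMoment
  refine HasStrictDerivAt.fun_sum fun j _ => ?_
  have h := (((hasStrictDerivAt_id t).const_mul (j : ℝ)).exp).const_mul ((j : ℝ) ^ k)
  refine h.congr_deriv ?_
  simp only [id]
  ring

/-- The variance of `j` under the law on `{0, …, ν}` with weights proportional to `e^{jt}`. -/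
def tiltedVariance (ν : ℕ) (t : ℝ) : ℝ :=
  (expMoment 2 ν t * expMoment 0 ν t - expMoment 1 ν t ^ 2) / expMoment 0 ν t ^ 2

theorem tiltedVariance_pos {ν : ℕ} (hν : ν ≠ 0) (t : ℝ) : 0 < tiltedVariance ν t := by
  have h0 := expMoment_zero_pos ν t
  set m := expMoment 1 ν t / expMoment 0 ν t with hm
  have hpos : 0 < ∑ j ∈ Finset.range (ν + 1), ((j : ℝ) - m) ^ 2 * Real.exp (j * t) := by
    refine Finset.sum_pos' (fun j _ => by positivity) ?_
    by_cases h : m = 0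
    · refine ⟨1, by simp; omega, ?_⟩
      simp only [h]
      positivity
    · refine ⟨0, by simp, ?_⟩
      rw [Nat.cast_zero, zero_sub, neg_sq]
      exact mul_pos (sq_pos_iff.2 h) (Real.exp_pos _)
  have hexp : ∑ j ∈ Finset.range (ν + 1), ((j : ℝ) - m) ^ 2 * Real.exp (j * t) =
      expMoment 2 ν t - 2 * m * expMoment 1 ν t + m ^ 2 * expMoment 0 ν t := by
    simp only [expMoment, Finset.mul_sum, ← Finset.sum_sub_distrib, ← Finset.sum_add_distrib]
    exact Finset.sum_congr rfl fun j _ => by ring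
  have hvar : tiltedVariance ν t =
      (expMoment 2 ν t - 2 * m * expMoment 1 ν t + m ^ 2 * expMoment 0 ν t) /
        expMoment 0 ν t := by
    rw [tiltedVariance, hm]
    field_simp
    ring
  rw [hvar, ← hexp]
  positivity

theorem mul_cosh_le_sinh_add {x : ℝ} (hx : 0 ≤ x) :
    x * Real.cosh x ≤ Real.sinh x + Real.sinh x ^ 3 / 3 := by
  have hderiv : ∀ y : ℝ, HasDerivAt
      (fun y => Real.sinh y + Real.sinh y ^ 3 / 3 - y * Real.cosh y)
      (Real.sinh y * (Real.sinh y * Real.cosh y - y)) y := fun y => by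
    have h := ((Real.hasDerivAt_sinh y).add (((Real.hasDerivAt_sinh y).pow 3).div_const 3)).sub
      ((hasDerivAt_id y).mul (Real.hasDerivAt_cosh y))
    refine h.congr_deriv ?_
    simp only [id]
    push_cast
    ring
  have hmono : MonotoneOn (fun y => Real.sinh y + Real.sinh y ^ 3 / 3 - y * Real.cosh y)
      (Set.Ici 0) := by
    refine monotoneOn_of_hasDerivWithinAt_nonneg (convex_Ici 0)
      (fun y _ => (hderiv y).continuousAt.continuousWithinAt)
      (fun y _ => (hderiv y).hasDerivWithinAt) fun y hy => ?_
    rw [interior_Ici, Set.mem_Ioi] at hy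
    have h1 : y ≤ Real.sinh y := Real.self_le_sinh_iff.2 hy.le
    have h2 := Real.one_le_cosh y
    exact mul_nonneg (by linarith) (by nlinarith)
  have h := hmono (Set.mem_Ici.2 le_rfl) (Set.mem_Ici.2 hx) hx
  simp at h
  linarith

theorem monotoneOn_sq_mul_inv_sinh_sq :
    MonotoneOn (fun x : ℝ => x ^ 2 * (1 / Real.sinh x ^ 2 + 1 / 3)) (Set.Ioi 0) := by
  have hderiv : ∀ x : ℝ, 0 < x → HasDerivAt
      (fun x => x ^ 2 * (1 / Real.sinh x ^ 2 + 1 / 3))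
      (2 * x / Real.sinh x ^ 3 *
        (Real.sinh x + Real.sinh x ^ 3 / 3 - x * Real.cosh x)) x := fun x hx => by
    have hs : Real.sinh x ≠ 0 := (Real.sinh_pos_iff.2 hx).ne'
    have h := ((hasDerivAt_id x).pow 2).mul
      ((((hasDerivAt_const x (1 : ℝ)).div ((Real.hasDerivAt_sinh x).pow 2)
        (pow_ne_zero 2 hs))).add_const (1 / 3))
    refine h.congr_deriv ?_
    simp
    field_simp
    ring
  refine monotoneOn_of_hasDerivWithinAt_nonneg (convex_Ioi 0)
    (fun y hy => (hderiv y hy).continuousAt.continuousWithinAt)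
    (fun y hy => (hderiv y (interior_subset hy)).hasDerivWithinAt) fun y hy => ?_
  have hy : 0 < y := interior_subset hy
  have hs : 0 < Real.sinh y := Real.sinh_pos_iff.2 hy
  exact mul_nonneg (by positivity) (sub_nonneg.2 (mul_cosh_le_sinh_add hy.le))

theorem four_mul_sinh_sq_mul_exp (x : ℝ) :
    4 * Real.sinh x ^ 2 * Real.exp (2 * x) = (Real.exp (2 * x) - 1) ^ 2 := by
  have h : Real.exp x * Real.exp (-x) = 1 := by rw [← Real.exp_add]; simp
  have h2 : Real.exp (2 * x) = Real.exp x ^ 2 := by rw [← Real.exp_nat_mul]; norm_num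
  rw [Real.sinh_eq, h2]
  linear_combination (Real.exp x * Real.exp (-x) + 1 - 2 * Real.exp x ^ 2) * h

theorem sq_exp_sub_one_inequality (ν : ℕ) {t : ℝ} (ht : 0 < t) :
    12 * (Real.exp t * (Real.exp t ^ (ν + 1) - 1) ^ 2 -
        ((ν : ℝ) + 1) ^ 2 * Real.exp t ^ (ν + 1) * (Real.exp t - 1) ^ 2) ≤
      ν * (ν + 2) * ((Real.exp t - 1) ^ 2 * (Real.exp t ^ (ν + 1) - 1) ^ 2) := by
  have hν : (0 : ℝ) ≤ ν := ν.cast_nonneg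
  set x := t / 2 with hx
  set N : ℝ := (ν : ℝ) + 1 with hN
  have hxpos : 0 < x := by positivity
  have hNpos : 0 < N := by positivity
  have hs : 0 < Real.sinh x := Real.sinh_pos_iff.2 hxpos
  have hS : 0 < Real.sinh (N * x) := Real.sinh_pos_iff.2 (by positivity)
  have hmono : x ^ 2 * (1 / Real.sinh x ^ 2 + 1 / 3) ≤
      (N * x) ^ 2 * (1 / Real.sinh (N * x) ^ 2 + 1 / 3) :=
    monotoneOn_sq_mul_inv_sinh_sq (Set.mem_Ioi.2 hxpos) (Set.mem_Ioi.2 (by positivity))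
      (by nlinarith)
  have hcore : 3 * Real.sinh (N * x) ^ 2 - 3 * N ^ 2 * Real.sinh x ^ 2 ≤
      (N ^ 2 - 1) * Real.sinh x ^ 2 * Real.sinh (N * x) ^ 2 := by
    field_simp at hmono
    rw [mul_comm x N] at hmono
    linarith
  have h1 := four_mul_sinh_sq_mul_exp x
  have h2 := four_mul_sinh_sq_mul_exp (N * x)
  have e1 : Real.exp (2 * x) = Real.exp t := by rw [hx]; ring_nf
  have e2 : Real.exp (2 * (N * x)) = Real.exp t ^ (ν + 1) := by
    rw [← Real.exp_nat_mul, hx, hN]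
    push_cast
    ring_nf
  rw [e1] at h1
  rw [e2] at h2
  have hmul := mul_le_mul_of_nonneg_left hcore
    (by positivity : 0 ≤ 16 * (Real.exp t * Real.exp t ^ (ν + 1)))
  rw [← h1, ← h2]
  have hN2 : (ν : ℝ) * (ν + 2) = N ^ 2 - 1 := by rw [hN]; ring
  rw [hN2]
  linarith

theorem geometric_moments (ν : ℕ) (r : ℝ) :
    (r - 1) * ∑ j ∈ Finset.range (ν + 1), r ^ j = r ^ (ν + 1) - 1 ∧
    (r - 1) ^ 2 * ∑ j ∈ Finset.range (ν + 1), (j : ℝ) * r ^ j =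
      ν * r ^ (ν + 2) - (ν + 1) * r ^ (ν + 1) + r ∧
    (r - 1) ^ 3 * ∑ j ∈ Finset.range (ν + 1), (j : ℝ) ^ 2 * r ^ j =
      ν ^ 2 * r ^ (ν + 3) - (2 * ν ^ 2 + 2 * ν - 1) * r ^ (ν + 2) +
        (ν + 1) ^ 2 * r ^ (ν + 1) - r ^ 2 - r := by
  induction ν with
  | zero => simp
  | succ ν ih =>
    obtain ⟨h0, h1, h2⟩ := ih
    refine ⟨?_, ?_, ?_⟩
    · rw [Finset.sum_range_succ, mul_add, h0]
      ring
    · rw [Finset.sum_range_succ, mul_add, h1]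
      push_cast
      ring
    · rw [Finset.sum_range_succ, mul_add, h2]
      push_cast
      ring

theorem tiltedVariance_zero (ν : ℕ) : tiltedVariance ν 0 = ν * (ν + 2) / 12 := by
  have h0 : expMoment 0 ν 0 = ν + 1 := by simp [expMoment]
  have h1 : expMoment 1 ν 0 = ν * (ν + 1) / 2 := by
    simp only [expMoment, pow_one, mul_zero, Real.exp_zero, mul_one]
    induction ν with
    | zero => simp
    | succ ν ih => rw [Finset.sum_range_succ, ih (by simp [expMoment])]; push_cast; ring
  have h2 : expMoment 2 ν 0 = ν * (ν + 1) * (2 * ν + 1) / 6 := by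
    clear h0 h1
    simp only [expMoment, mul_zero, Real.exp_zero, mul_one]
    induction ν with
    | zero => simp
    | succ ν ih => rw [Finset.sum_range_succ, ih]; push_cast; ring
  rw [tiltedVariance, h0, h1, h2]
  field_simp
  ring

theorem tiltedVariance_le (ν : ℕ) {t : ℝ} (ht : 0 ≤ t) :
    tiltedVariance ν t ≤ ν * (ν + 2) / 12 := by
  rcases ht.eq_or_lt with rfl | ht
  · exact (tiltedVariance_zero ν).le
  have hmoment : ∀ k, expMoment k ν t =
      ∑ j ∈ Finset.range (ν + 1), (j : ℝ) ^ k * Real.exp t ^ j := fun k =>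
    Finset.sum_congr rfl fun j _ => by rw [Real.exp_nat_mul]
  have hineq := sq_exp_sub_one_inequality ν ht
  obtain ⟨h0, h1, h2⟩ := geometric_moments ν (Real.exp t)
  have hpos := expMoment_zero_pos ν t
  have hr : 0 < Real.exp t - 1 := by linarith [Real.add_one_lt_exp ht.ne']
  replace h0 : (Real.exp t - 1) * expMoment 0 ν t = Real.exp t ^ (ν + 1) - 1 := by
    rw [hmoment 0, ← h0]; simp
  replace h1 : (Real.exp t - 1) ^ 2 * expMoment 1 ν t =
      ν * Real.exp t ^ (ν + 2) - (ν + 1) * Real.exp t ^ (ν + 1) + Real.exp t := by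
    rw [hmoment 1, ← h1]; simp
  rw [← hmoment 2] at h2
  rw [tiltedVariance, div_le_div_iff₀ (by positivity) (by norm_num)]
  refine le_of_mul_le_mul_left ?_ (pow_pos hr 4)
  generalize Real.exp t = r at *
  have hvar : (r - 1) ^ 4 * (expMoment 2 ν t * expMoment 0 ν t - expMoment 1 ν t ^ 2) =
      r * (r ^ (ν + 1) - 1) ^ 2 - ((ν : ℝ) + 1) ^ 2 * r ^ (ν + 1) * (r - 1) ^ 2 := by
    calc _ = ((r - 1) ^ 3 * expMoment 2 ν t) * ((r - 1) * expMoment 0 ν t) -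
          ((r - 1) ^ 2 * expMoment 1 ν t) ^ 2 := by ring
      _ = _ := by rw [h0, h1, h2]; ring
  calc _ = 12 * ((r - 1) ^ 4 *
        (expMoment 2 ν t * expMoment 0 ν t - expMoment 1 ν t ^ 2)) := by ring
    _ ≤ ν * (ν + 2) * ((r - 1) ^ 2 * (r ^ (ν + 1) - 1) ^ 2) := by rw [hvar]; exact hineq
    _ = _ := by rw [← h0]; ring

theorem ZnR_eq_prod_expMoment (n : ℕ) (β : ℝ) :
    ZnR n β = ∏ p ∈ n.primeFactors,
      expMoment 0 (n.factorization p) (Real.log p * β) / ((n.factorization p : ℝ) + 1) := by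
  refine Finset.prod_congr rfl fun p hp => ?_
  have hp0 : (0 : ℝ) < p := by exact_mod_cast (Nat.prime_of_mem_primeFactors hp).pos
  congr 1
  refine Finset.sum_congr rfl fun j _ => ?_
  rw [Real.rpow_def_of_pos hp0, pow_zero, one_mul]
  ring_nf

theorem phiN_eq_sum (n : ℕ) (β : ℝ) :
    phiN n β = ∑ p ∈ n.primeFactors,
      Real.log (expMoment 0 (n.factorization p) (Real.log p * β) /
        ((n.factorization p : ℝ) + 1)) := by
  rw [phiN, ZnR_eq_prod_expMoment, Real.log_prod]
  intro p _
  have := expMoment_zero_pos (n.factorization p) (Real.log p * β)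
  positivity

theorem hasStrictDerivAt_expMoment_comp (k ν : ℕ) (c β : ℝ) :
    HasStrictDerivAt (fun β => expMoment k ν (c * β)) (c * expMoment (k + 1) ν (c * β)) β := by
  have h := (hasStrictDerivAt_expMoment k ν (c * β)).comp β ((hasStrictDerivAt_id β).const_mul c)
  exact h.congr_deriv (by ring)

theorem deriv_phiN (n : ℕ) :
    deriv (phiN n) = fun β => ∑ p ∈ n.primeFactors,
      Real.log p * expMoment 1 (n.factorization p) (Real.log p * β) /
        expMoment 0 (n.factorization p) (Real.log p * β) := by
  ext β
  rw [funext (phiN_eq_sum n)]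
  refine HasDerivAt.deriv (HasDerivAt.fun_sum fun p _ => ?_)
  have hpos := expMoment_zero_pos (n.factorization p) (Real.log p * β)
  have h := ((hasStrictDerivAt_expMoment_comp 0 (n.factorization p) (Real.log p)
    β).hasDerivAt.div_const ((n.factorization p : ℝ) + 1)).log (by positivity)
  refine h.congr_deriv ?_
  field_simp

theorem hasStrictDerivAt_deriv_phiN (n : ℕ) (β : ℝ) :
    HasStrictDerivAt (deriv (phiN n))
      (∑ p ∈ n.primeFactors,
        Real.log p ^ 2 * tiltedVariance (n.factorization p) (Real.log p * β)) β := by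
  rw [deriv_phiN]
  refine HasStrictDerivAt.fun_sum fun p _ => ?_
  have hpos := expMoment_zero_pos (n.factorization p) (Real.log p * β)
  have h := ((hasStrictDerivAt_expMoment_comp 1 (n.factorization p) (Real.log p)
    β).const_mul (Real.log p)).fun_div
      (hasStrictDerivAt_expMoment_comp 0 (n.factorization p) (Real.log p) β) hpos.ne'
  refine h.congr_deriv ?_
  rw [tiltedVariance]
  ring

theorem log_pos_of_mem_primeFactors {n p : ℕ} (hp : p ∈ n.primeFactors) :
    0 < Real.log (p : ℝ) :=
  Real.log_pos (by exact_mod_cast (Nat.prime_of_mem_primeFactors hp).one_lt)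

theorem factorization_ne_zero_of_mem_primeFactors {n p : ℕ} (hp : p ∈ n.primeFactors) :
    n.factorization p ≠ 0 :=
  Finsupp.mem_support_iff.1 (by rwa [Nat.support_factorization])

theorem sum_tiltedVariance_pos {n : ℕ} (hn : 1 < n) (β : ℝ) :
    0 < ∑ p ∈ n.primeFactors,
      Real.log p ^ 2 * tiltedVariance (n.factorization p) (Real.log p * β) :=
  Finset.sum_pos (fun _ hp => mul_pos (pow_pos (log_pos_of_mem_primeFactors hp) 2)
    (tiltedVariance_pos (factorization_ne_zero_of_mem_primeFactors hp) _))
    (Nat.nonempty_primeFactors.2 hn)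

theorem sum_tiltedVariance_le_m2 (n : ℕ) {β : ℝ} (hβ : 0 ≤ β) :
    ∑ p ∈ n.primeFactors,
      Real.log p ^ 2 * tiltedVariance (n.factorization p) (Real.log p * β) ≤ m2 n := by
  rw [m2, Finset.mul_sum]
  refine Finset.sum_le_sum fun p hp => ?_
  have h := mul_le_mul_of_nonneg_left (tiltedVariance_le (n.factorization p)
    (mul_nonneg (log_pos_of_mem_primeFactors hp).le hβ)) (sq_nonneg (Real.log (p : ℝ)))
  linarith

theorem strictMono_deriv_phiN {n : ℕ} (hn : 1 < n) : StrictMono (deriv (phiN n)) :=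
  strictMono_of_hasDerivAt_pos (fun β => (hasStrictDerivAt_deriv_phiN n β).hasDerivAt)
    (sum_tiltedVariance_pos hn)

/-- A right inverse on a set of an injective strictly differentiable function, precomposed with
an affine map, is differentiable within that set. -/
theorem HasStrictDerivAt.hasDerivWithinAt_of_eqOn_affine {g b : ℝ → ℝ} {s : Set ℝ}
    {v c d z : ℝ} (hg : Function.Injective g) (hz : z ∈ s) (hv : v ≠ 0)
    (hderiv : HasStrictDerivAt g v (b z)) (hb : ∀ y ∈ s, g (b y) = c + y * d) :
    HasDerivWithinAt b (d / v) s z := by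
  have hinv := (hderiv.to_localInverse hv).hasDerivAt
  have hright := (hderiv.hasStrictFDerivAt_equiv hv).eventually_right_inverse
  rw [hb z hz] at hinv hright
  have haff : HasDerivAt (fun y : ℝ => c + y * d) d z := by
    simpa using ((hasDerivAt_id z).mul_const d).const_add c
  have hcomp := hinv.comp z haff
  have heq : ∀ y ∈ s, g (hderiv.localInverse g v (b z) hv (c + y * d)) = c + y * d →
      b y = hderiv.localInverse g v (b z) hv (c + y * d) :=
    fun y hy h => hg ((hb y hy).trans h.symm)
  have hev := haff.continuousAt.eventually hright
  refine (hcomp.hasDerivWithinAt.congr_of_eventuallyEq ?_ (heq z hz hev.self_of_nhds)).congr_deriv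
    (by ring)
  filter_upwards [self_mem_nhdsWithin, nhdsWithin_le_nhds hev] with y hy h
  exact heq y hy h

/-- **Lemma 4.2**: the saddle point `β_n(z)` satisfies `β_n'(z) ≥ 1/σ_n`. -/
theorem stmt13 :
    ∀ n : ℕ, 1 < n → ∀ βf : ℝ → ℝ,
      (∀ z ∈ Set.Ico (0:ℝ) (Real.log n / (2 * sigman n)),
        0 ≤ βf z ∧ deriv (phiN n) (βf z) = (1/2) * Real.log n + z * sigman n) →
      ∀ z ∈ Set.Ico (0:ℝ) (Real.log n / (2 * sigman n)),
        DifferentiableWithinAt ℝ βf (Set.Ico 0 (Real.log n / (2 * sigman n))) z ∧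
          1 / sigman n ≤ derivWithin βf (Set.Ico 0 (Real.log n / (2 * sigman n))) z := by
  intro n hn βf hβ z hz
  obtain ⟨hβz, -⟩ := hβ z hz
  have hpos := sum_tiltedVariance_pos hn (βf z)
  have hle := sum_tiltedVariance_le_m2 n hβz
  have hσ : 0 < sigman n := Real.sqrt_pos.2 (hpos.trans_le hle)
  have hd := (hasStrictDerivAt_deriv_phiN n (βf z)).hasDerivWithinAt_of_eqOn_affine
    (strictMono_deriv_phiN hn).injective hz hpos.ne' fun y hy => (hβ y hy).2
  refine ⟨hd.differentiableWithinAt, ?_⟩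
  rw [hd.derivWithin (uniqueDiffOn_Ico _ _ z hz), div_le_div_iff₀ hσ hpos, one_mul, ← sq]
  exact hle.trans_eq (Real.sq_sqrt (hpos.trans_le hle).le).symm

end
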